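/- arXiv:hep-th/0602248 — 2 statements merged into one kernel-verified Lean document; each statement's English description precedes it below -/
import Mathlib

section
/- For every integer r and complex q with |q| < 1: sum_{p,i,j >= 0} q^{C(p-2j+1,2) + C(p-r-2i,2) + j} / ( (q;q)_{p-r-2i} (q;q)_i (q;q)_{p-2j} (q;q)_j ) = V_r(q), i.e. the triple sum equals (q;q)_inf^{-1} sum_{i,j >= 0} q^{C(2j-2i-r,2)+j} / ((q;q)_i (q;q)_j). (Terms with p-r-2i < 0 or p-2j < 0 vanish by the convention 1/(q;q)_n = 0 for negative n.) -/
open scoped BigOperators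

noncomputable section

/-- Finite q-Pochhammer symbol `(a;q)_n`. -/
def qP (q a : ℂ) (n : ℕ) : ℂ := ∏ m ∈ Finset.range n, (1 - a * q ^ m)

/-- Infinite q-Pochhammer symbol `(a;q)_∞`. -/
def qPInf (q a : ℂ) : ℂ := ∏' m : ℕ, (1 - a * q ^ m)

/-- `1/(q;q)_n` for `n : ℤ`, equal to `0` for negative `n`. -/
def invQ (q : ℂ) (n : ℤ) : ℂ := if 0 ≤ n then (qP q q n.toNat)⁻¹ else 0

/-- `C(n,2) = n(n-1)/2` for `n : ℤ` (exact integer division). -/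
def ch2 (n : ℤ) : ℤ := n * (n - 1) / 2


lemma two_ch2 (n : ℤ) : 2 * ch2 n = n * (n - 1) := by
  unfold ch2
  exact Int.mul_ediv_cancel' (Int.even_mul_pred_self n).two_dvd

lemma ch2_nonneg (n : ℤ) : 0 ≤ ch2 n := by
  have h := two_ch2 n
  rcases le_or_gt n 0 with h0 | h0 <;> nlinarith

lemma factor_ne (q : ℂ) (hq : ‖q‖ < 1) (m : ℕ) : 1 - q * q ^ m ≠ 0 := by
  intro h
  have h1 : q ^ (m + 1) = 1 := by rw [pow_succ']; linear_combination -h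
  have h2 : ‖q‖ ^ (m + 1) = 1 := by rw [← norm_pow, h1, norm_one]
  have h3 := pow_lt_one₀ (norm_nonneg q) hq (Nat.succ_ne_zero m)
  simp only [Nat.succ_eq_add_one] at h3
  linarith

lemma qP_ne (q : ℂ) (hq : ‖q‖ < 1) (n : ℕ) : qP q q n ≠ 0 :=
  Finset.prod_ne_zero_iff.mpr fun m _ => factor_ne q hq m

lemma qP_succ (q : ℂ) (n : ℕ) : qP q q (n + 1) = qP q q n * (1 - q ^ (n + 1)) := by
  unfold qP
  rw [Finset.prod_range_succ, pow_succ']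

lemma summ_norm (q : ℂ) (hq : ‖q‖ < 1) : Summable fun m : ℕ => ‖-(q * q ^ m)‖ := by
  simp only [norm_neg, norm_mul, norm_pow]
  exact (summable_geometric_of_lt_one (norm_nonneg q) hq).mul_left _

lemma qPInf_ne (q : ℂ) (hq : ‖q‖ < 1) : qPInf q q ≠ 0 := by
  unfold qPInf
  have := tprod_one_add_ne_zero_of_summable (f := fun m : ℕ => -(q * q ^ m))
    (fun m => by simpa [sub_eq_add_neg] using factor_ne q hq m) (summ_norm q hq)
  simpa [sub_eq_add_neg] using this

lemma qP_tendsto (q : ℂ) (hq : ‖q‖ < 1) :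
    Filter.Tendsto (fun n => qP q q n) Filter.atTop (nhds (qPInf q q)) := by
  have h := (multipliable_one_add_of_summable (summ_norm q hq)).tendsto_prod_tprod_nat
  simpa [qP, qPInf, sub_eq_add_neg] using h

lemma inv_tendsto (q : ℂ) (hq : ‖q‖ < 1) :
    Filter.Tendsto (fun n => (qP q q n)⁻¹) Filter.atTop (nhds (qPInf q q)⁻¹) :=
  (qP_tendsto q hq).inv₀ (qPInf_ne q hq)

lemma inv_bound (q : ℂ) (hq : ‖q‖ < 1) : ∃ K : ℝ, 0 ≤ K ∧ ∀ n, ‖(qP q q n)⁻¹‖ ≤ K := by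
  obtain ⟨K, hK⟩ := (Metric.isBounded_range_of_tendsto _ (inv_tendsto q hq)).exists_norm_le
  exact ⟨K, (norm_nonneg _).trans (hK _ ⟨0, rfl⟩), fun n => hK _ ⟨n, rfl⟩⟩

/-- Summand of the Durfee rectangle identity. -/
def durf (q : ℂ) (k n : ℕ) : ℂ := q ^ (n * (n + k)) * ((qP q q n)⁻¹ * (qP q q (n + k))⁻¹)

lemma durf_bound (q : ℂ) (hq : ‖q‖ < 1) :
    ∃ K : ℝ, 0 ≤ K ∧ ∀ k n, ‖durf q k n‖ ≤ K * ‖q‖ ^ n := by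
  obtain ⟨K, h0, hK⟩ := inv_bound q hq
  refine ⟨K * K, by positivity, fun k n => ?_⟩
  unfold durf
  rw [norm_mul, norm_mul, norm_pow, mul_comm]
  have h1 : n ≤ n * (n + k) := by
    rcases Nat.eq_zero_or_pos n with h | h
    · simp [h]
    · exact Nat.le_mul_of_pos_right _ (by omega)
  have h2 := pow_le_pow_of_le_one (norm_nonneg q) hq.le h1
  have := hK n
  have := hK (n + k)
  gcongr

lemma durf_summable (q : ℂ) (hq : ‖q‖ < 1) (k : ℕ) : Summable (durf q k) := by
  obtain ⟨K, h0, hK⟩ := durf_bound q hq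
  exact Summable.of_norm_bounded
    ((summable_geometric_of_lt_one (norm_nonneg q) hq).mul_left K) (hK k)

lemma durf_tele (q : ℂ) (hq : ‖q‖ < 1) (k N : ℕ) :
    ∑ n ∈ Finset.range N, (durf q k n - durf q (k + 1) n) = -(1 - q ^ N) * durf q k N := by
  induction N with
  | zero => simp
  | succ N ih =>
    rw [Finset.sum_range_succ, ih]
    unfold durf
    have e1 : N + 1 + k = N + k + 1 := by ring
    have e2 : N + (k + 1) = N + k + 1 := by ring
    rw [e1, e2]
    have a1 := qP_ne q hq N
    have a2 := qP_ne q hq (N + k)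
    have b1 : 1 - q ^ (N + 1) ≠ 0 := by rw [pow_succ']; exact factor_ne q hq N
    have b2 : 1 - q ^ (N + k + 1) ≠ 0 := by rw [pow_succ']; exact factor_ne q hq (N + k)
    rw [qP_succ, qP_succ]
    field_simp
    ring

lemma durf_step (q : ℂ) (hq : ‖q‖ < 1) (k : ℕ) :
    ∑' n, durf q k n = ∑' n, durf q (k + 1) n := by
  have h1 := ((durf_summable q hq k).sub (durf_summable q hq (k + 1))).hasSum.tendsto_sum_nat
  have h2 : Filter.Tendsto (fun N => -(1 - q ^ N) * durf q k N) Filter.atTop (nhds 0) := by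
    have h3 := (durf_summable q hq k).tendsto_atTop_zero
    have h4 := tendsto_pow_atTop_nhds_zero_of_norm_lt_one hq
    simpa using ((h4.const_sub 1).neg).mul h3
  simp only [durf_tele q hq] at h1
  have h5 := tendsto_nhds_unique h1 h2
  rw [(durf_summable q hq k).tsum_sub (durf_summable q hq (k + 1))] at h5
  exact sub_eq_zero.mp h5

lemma durf_tsum (q : ℂ) (hq : ‖q‖ < 1) (k : ℕ) : ∑' n, durf q k n = (qPInf q q)⁻¹ := by
  have hc : ∀ k, ∑' n, durf q k n = ∑' n, durf q 0 n := by
    intro k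
    induction k with
    | zero => rfl
    | succ k ih => rw [← durf_step q hq, ih]
  obtain ⟨K, h0, hK⟩ := durf_bound q hq
  have hlim : Filter.Tendsto (fun k => ∑' n, durf q k n) Filter.atTop
      (nhds (∑' n : ℕ, if n = 0 then (qPInf q q)⁻¹ else 0)) := by
    refine tendsto_tsum_of_dominated_convergence
      ((summable_geometric_of_lt_one (norm_nonneg q) hq).mul_left K) ?_
      (Filter.Eventually.of_forall fun k n => hK k n)
    intro n
    rcases Nat.eq_zero_or_pos n with rfl | hn
    · simpa [durf, qP] using inv_tendsto q hq
    · rw [if_neg hn.ne']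
      unfold durf
      have t1 : Filter.Tendsto (fun k => (qP q q (n + k))⁻¹) Filter.atTop
          (nhds (qPInf q q)⁻¹) := by
        have := (Filter.tendsto_add_atTop_iff_nat n).mpr (inv_tendsto q hq)
        simpa [add_comm] using this
      have t2 : Filter.Tendsto (fun k => q ^ (n * (n + k))) Filter.atTop (nhds 0) := by
        refine (tendsto_pow_atTop_nhds_zero_of_norm_lt_one hq).comp ?_
        refine Filter.tendsto_atTop_mono (fun k => ?_) Filter.tendsto_id
        simp only [id]
        nlinarith
      simpa using t2.mul (t1.const_mul (qP q q n)⁻¹)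
  simp only [tsum_ite_eq] at hlim
  have hconst : (fun k => ∑' n, durf q k n) = fun _ => ∑' n, durf q 0 n := funext hc
  rw [hconst] at hlim
  rw [hc k]
  exact tendsto_nhds_unique tendsto_const_nhds hlim

lemma durf_hasSum (q : ℂ) (hq : ‖q‖ < 1) (k : ℕ) : HasSum (durf q k) (qPInf q q)⁻¹ := by
  rw [← durf_tsum q hq k]
  exact (durf_summable q hq k).hasSum

lemma invQ_nat (q : ℂ) (n : ℕ) : invQ q (n : ℤ) = (qP q q n)⁻¹ := by simp [invQ]

lemma invQ_neg (q : ℂ) (n : ℤ) (h : n < 0) : invQ q n = 0 := by simp [invQ, h]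

/-- The full summand. -/
def trm (r : ℤ) (q : ℂ) (i j p : ℕ) : ℂ :=
  q ^ (ch2 ((p : ℤ) - 2 * (j : ℤ) + 1) + ch2 ((p : ℤ) - r - 2 * (i : ℤ)) + (j : ℤ)) *
        (invQ q ((p : ℤ) - r - 2 * (i : ℤ)) * (qP q q i)⁻¹ *
          invQ q ((p : ℤ) - 2 * (j : ℤ)) * (qP q q j)⁻¹)

lemma trm_hasSum (r : ℤ) (q : ℂ) (hq : ‖q‖ < 1) (i j : ℕ) :
    HasSum (trm r q i j) ((qPInf q q)⁻¹ * (q ^ (ch2 (2 * (j : ℤ) - 2 * (i : ℤ) - r) + (j : ℤ)) *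
            ((qP q q i)⁻¹ * (qP q q j)⁻¹))) := by
  obtain ⟨e, he⟩ : ∃ e : ℕ, ch2 (2 * (j : ℤ) - 2 * (i : ℤ) - r) + (j : ℤ) = (e : ℤ) :=
    ⟨_, (Int.toNat_of_nonneg (add_nonneg (ch2_nonneg _) (Int.natCast_nonneg j))).symm⟩
  have main : ∃ (g : ℕ → ℕ) (k : ℕ), Function.Injective g ∧
      (∀ p, p ∉ Set.range g → trm r q i j p = 0) ∧
      ∀ n, trm r q i j (g n) = durf q k n * (q ^ e * ((qP q q i)⁻¹ * (qP q q j)⁻¹)) := by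
    have hs := two_ch2 (2 * (j : ℤ) - 2 * (i : ℤ) - r)
    rcases le_total 0 (2 * (j : ℤ) - 2 * (i : ℤ) - r) with h | h
    · obtain ⟨k, hk⟩ := Int.eq_ofNat_of_zero_le h
      refine ⟨fun n => 2 * j + n, k, fun a b hab => by simpa using hab, ?_, ?_⟩
      · intro p hp
        have : p < 2 * j := by
          by_contra hc
          exact hp ⟨p - 2 * j, by simp only; omega⟩
        unfold trm
        rw [invQ_neg q ((p : ℤ) - 2 * j) (by omega)]
        ring
      · intro n
        unfold trm durf
        have c1 : ((2 * j + n : ℕ) : ℤ) - 2 * (j : ℤ) = (n : ℕ) := by push_cast; ring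
        have c2 : ((2 * j + n : ℕ) : ℤ) - r - 2 * (i : ℤ) = (n + k : ℕ) := by
          push_cast; linarith
        rw [c1, c2, invQ_nat, invQ_nat]
        have hE : ch2 ((n : ℤ) + 1) + ch2 ((n + k : ℕ) : ℤ) + j = ((n * (n + k) + e : ℕ) : ℤ) := by
          have h1 := two_ch2 ((n : ℤ) + 1)
          have h2 := two_ch2 ((n + k : ℕ) : ℤ)
          rw [hk] at hs he
          push_cast at *
          linarith
        rw [hE, zpow_natCast, pow_add]
        ring
    · obtain ⟨k, hk⟩ := Int.eq_ofNat_of_zero_le (neg_nonneg.mpr h)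
      refine ⟨fun n => 2 * j + k + n, k, fun a b hab => by simpa using hab, ?_, ?_⟩
      · intro p hp
        have : p < 2 * j + k := by
          by_contra hc
          exact hp ⟨p - (2 * j + k), by simp only; omega⟩
        unfold trm
        rw [invQ_neg q ((p : ℤ) - r - 2 * i) (by omega)]
        ring
      · intro n
        unfold trm durf
        have c1 : ((2 * j + k + n : ℕ) : ℤ) - 2 * (j : ℤ) = (n + k : ℕ) := by push_cast; ring
        have c2 : ((2 * j + k + n : ℕ) : ℤ) - r - 2 * (i : ℤ) = (n : ℕ) := by
          push_cast; linarith
        rw [c1, c2, invQ_nat, invQ_nat]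
        have hk' : 2 * (j : ℤ) - 2 * (i : ℤ) - r = -(k : ℤ) := by linarith
        have hE : ch2 (((n + k : ℕ) : ℤ) + 1) + ch2 (n : ℤ) + j = ((n * (n + k) + e : ℕ) : ℤ) := by
          have h1 := two_ch2 (((n + k : ℕ) : ℤ) + 1)
          have h2 := two_ch2 (n : ℤ)
          rw [hk'] at hs he
          push_cast at *
          linarith
        rw [hE, zpow_natCast, pow_add]
        ring
  obtain ⟨g, k, hg, h0, hd⟩ := main
  rw [he, zpow_natCast, ← hg.hasSum_iff h0]
  have := (durf_hasSum q hq k).mul_right (q ^ e * ((qP q q i)⁻¹ * (qP q q j)⁻¹))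
  have hfun : trm r q i j ∘ g =
      fun n => durf q k n * (q ^ e * ((qP q q i)⁻¹ * (qP q q j)⁻¹)) := funext hd
  rw [hfun]
  exact this

lemma ch2_summable (Q : ℝ) (h0 : 0 ≤ Q) (h1 : Q < 1) :
    Summable fun n : ℤ => Q ^ (ch2 n).toNat := by
  have hg := summable_geometric_of_lt_one h0 h1
  refine Summable.of_nat_of_neg ?_ ?_
  · rw [← summable_nat_add_iff 1]
    refine Summable.of_nonneg_of_le (fun n => by positivity) (fun n => ?_) hg
    refine pow_le_pow_of_le_one h0 h1.le ?_
    have := two_ch2 ((n + 1 : ℕ) : ℤ)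
    have h : (n : ℤ) ≤ ch2 ((n + 1 : ℕ) : ℤ) := by
      push_cast at *
      rcases Nat.eq_zero_or_pos n with rfl | hn
      · exact ch2_nonneg _
      · have : (1 : ℤ) ≤ n := by exact_mod_cast hn
        nlinarith
    omega
  · refine Summable.of_nonneg_of_le (fun n => by positivity) (fun n => ?_) hg
    refine pow_le_pow_of_le_one h0 h1.le ?_
    have := two_ch2 (-(n : ℤ))
    have h : (n : ℤ) ≤ ch2 (-(n : ℤ)) := by
      rcases Nat.eq_zero_or_pos n with rfl | hn
      · exact ch2_nonneg _
      · have : (1 : ℤ) ≤ n := by exact_mod_cast hn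
        nlinarith
    omega

lemma invQ_bound (q : ℂ) (K : ℝ) (h0 : 0 ≤ K) (hK : ∀ n, ‖(qP q q n)⁻¹‖ ≤ K) (n : ℤ) :
    ‖invQ q n‖ ≤ K := by
  unfold invQ
  split_ifs
  · exact hK _
  · simpa using h0

lemma trm_summable (r : ℤ) (q : ℂ) (hq : ‖q‖ < 1) :
    Summable fun x : (ℕ × ℕ) × ℕ => trm r q x.1.1 x.1.2 x.2 := by
  obtain ⟨K, h0, hK⟩ := inv_bound q hq
  have hs := ch2_summable ‖q‖ (norm_nonneg q) hq
  have hs1 : Summable fun n : ℤ => ‖q‖ ^ (ch2 (n + 1)).toNat :=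
    hs.comp_injective (add_left_injective 1)
  have hg := summable_geometric_of_lt_one (norm_nonneg q) hq
  have h3 := (hs1.mul_of_nonneg hs (fun n => by positivity) (fun n => by positivity)).mul_of_nonneg
    hg (fun n => by positivity) (fun n => by positivity)
  have hinj : Function.Injective fun x : (ℕ × ℕ) × ℕ =>
      ((((x.2 : ℤ) - 2 * (x.1.2 : ℤ), (x.2 : ℤ) - r - 2 * (x.1.1 : ℤ)), x.1.2) : (ℤ × ℤ) × ℕ) := by
    rintro ⟨⟨i, j⟩, p⟩ ⟨⟨i', j'⟩, p'⟩ h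
    simp only [Prod.mk.injEq] at h ⊢
    omega
  refine Summable.of_norm_bounded ((h3.comp_injective hinj).mul_right (K * K * K * K)) ?_
  rintro ⟨⟨i, j⟩, p⟩
  simp only [trm, Function.comp]
  have e1 : ch2 ((p : ℤ) - 2 * (j : ℤ) + 1) + ch2 ((p : ℤ) - r - 2 * (i : ℤ)) + (j : ℤ) =
      (((ch2 ((p : ℤ) - 2 * (j : ℤ) + 1)).toNat + (ch2 ((p : ℤ) - r - 2 * (i : ℤ))).toNat + j : ℕ)
        : ℤ) := by
    push_cast
    rw [Int.toNat_of_nonneg (ch2_nonneg _), Int.toNat_of_nonneg (ch2_nonneg _)]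
  rw [e1, zpow_natCast, norm_mul, norm_pow, pow_add, pow_add]
  simp only [norm_mul]
  have i1 := invQ_bound q K h0 hK ((p : ℤ) - r - 2 * (i : ℤ))
  have i2 := invQ_bound q K h0 hK ((p : ℤ) - 2 * (j : ℤ))
  have i3 := hK i
  have i4 := hK j
  gcongr

/-- The quadruple-sum form of the graded Verma character reduces to the double sum. -/
theorem verma_triple_sum (r : ℤ) (q : ℂ) (hq : ‖q‖ < 1) :
    (∑' x : ℕ × ℕ × ℕ,
      q ^ (ch2 ((x.1 : ℤ) - 2 * (x.2.2 : ℤ) + 1) + ch2 ((x.1 : ℤ) - r - 2 * (x.2.1 : ℤ))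
          + (x.2.2 : ℤ)) *
        (invQ q ((x.1 : ℤ) - r - 2 * (x.2.1 : ℤ)) * (qP q q x.2.1)⁻¹ *
          invQ q ((x.1 : ℤ) - 2 * (x.2.2 : ℤ)) * (qP q q x.2.2)⁻¹))
    = (qPInf q q)⁻¹ *
        ∑' ij : ℕ × ℕ,
          q ^ (ch2 (2 * (ij.2 : ℤ) - 2 * (ij.1 : ℤ) - r) + (ij.2 : ℤ)) *
            ((qP q q ij.1)⁻¹ * (qP q q ij.2)⁻¹) := by
  have hsum := trm_summable r q hq
  rw [← tsum_mul_left]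
  have h1 := hsum.tsum_prod
  simp only [(trm_hasSum r q hq _ _).tsum_eq] at h1
  rw [← h1]
  let E : ((ℕ × ℕ) × ℕ) ≃ ℕ × ℕ × ℕ := Equiv.prodComm _ _
  rw [← E.tsum_eq]
  rfl
end
end

section
/- For complex q, z with |q| < 1 and |z| < 1: (-z;q)_inf / (z^2;q)_inf = sum_{p >= 0} z^p sum_{j = 0}^{floor(p/2)} q^{C(p-2j,2)} / ( (q;q)_{p-2j} (q;q)_j ). (The coefficient of z^p on the right is the generating function of jagged partitions of length at most p.) -/
open scoped BigOperators

noncomputable section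

open Filter Topology

lemma one_sub_ne {q : ℂ} (hq : ‖q‖ < 1) (n : ℕ) : 1 - q ^ (n + 1) ≠ 0 := by
  intro h
  have h1 : q ^ (n + 1) = 1 := (sub_eq_zero.mp h).symm
  have h2 : ‖q‖ ^ (n + 1) = 1 := by rw [← norm_pow, h1, norm_one]
  have h3 : ‖q‖ ^ (n + 1) < 1 := pow_lt_one₀ (norm_nonneg _) hq (Nat.succ_ne_zero n)
  linarith

lemma inv_qP_succ {q : ℂ} (hq : ‖q‖ < 1) (n : ℕ) :
    (qP q q (n + 1))⁻¹ * (1 - q ^ (n + 1)) = (qP q q n)⁻¹ := by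
  have h := one_sub_ne hq n
  have : qP q q (n + 1) = qP q q n * (1 - q ^ (n + 1)) := by
    unfold qP
    rw [Finset.prod_range_succ, pow_succ' q n]
  rw [this, mul_inv, mul_assoc, inv_mul_cancel₀ h, mul_one]

lemma summable_b {q z : ℂ} (hq : ‖q‖ < 1) (hz : ‖z‖ < 1) :
    Summable (fun n : ℕ => ‖(qP q q n)⁻¹ * z ^ n‖) := by
  obtain ⟨r, hr1, hr2⟩ := exists_between hz
  refine summable_of_ratio_norm_eventually_le (r := r) hr2 ?_
  have ht : Tendsto (fun n : ℕ => r * ‖1 - q ^ (n + 1)‖) atTop (𝓝 (r * ‖(1 : ℂ) - 0‖)) := by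
    have h0 : Tendsto (fun n : ℕ => q ^ (n + 1)) atTop (𝓝 0) :=
      (tendsto_add_atTop_iff_nat 1).mpr (tendsto_pow_atTop_nhds_zero_of_norm_lt_one hq)
    exact ((tendsto_const_nhds.sub h0).norm).const_mul r
  have hr : ‖z‖ < r * ‖(1 : ℂ) - 0‖ := by simpa using hr1
  filter_upwards [ht.eventually (lt_mem_nhds hr)] with n hn
  rw [norm_norm, norm_norm, ← inv_qP_succ hq n, pow_succ, norm_mul, norm_mul, norm_mul, norm_mul]
  have h1 : 0 ≤ ‖(qP q q (n + 1))⁻¹‖ * ‖z ^ n‖ := by positivity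
  nlinarith [mul_le_mul_of_nonneg_left hn.le h1]

lemma summable_a {q z : ℂ} (hq : ‖q‖ < 1) (hz : ‖z‖ < 1) :
    Summable (fun n : ℕ => ‖q ^ (Nat.choose n 2) * (qP q q n)⁻¹ * z ^ n‖) := by
  refine Summable.of_nonneg_of_le (fun _ => norm_nonneg _) (fun n => ?_) (summable_b hq hz)
  rw [mul_assoc, norm_mul, norm_pow]
  exact mul_le_of_le_one_left (norm_nonneg _) (pow_le_one₀ (norm_nonneg _) hq.le)

lemma norm_mul_pow_le {q z : ℂ} (hq : ‖q‖ < 1) (N : ℕ) : ‖z * q ^ N‖ ≤ ‖z‖ := by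
  rw [norm_mul, norm_pow]
  exact mul_le_of_le_one_right (norm_nonneg _) (pow_le_one₀ (norm_nonneg _) hq.le)

lemma tendsto_series {q z : ℂ} (hq : ‖q‖ < 1) (c : ℕ → ℂ)
    (hc : Summable (fun n : ℕ => ‖c n * z ^ n‖)) :
    Tendsto (fun N : ℕ => ∑' n, c n * (z * q ^ N) ^ n) atTop (𝓝 (c 0)) := by
  have h0 : ∑' n, c n * (0 : ℂ) ^ n = c 0 := by
    rw [tsum_eq_single 0]
    · simp
    · intro n hn; simp [hn]
  rw [← h0]
  refine tendsto_tsum_of_dominated_convergence hc (fun n => ?_) (Eventually.of_forall ?_)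
  · have : Tendsto (fun N : ℕ => z * q ^ N) atTop (𝓝 (z * 0)) :=
      (tendsto_pow_atTop_nhds_zero_of_norm_lt_one hq).const_mul z
    rw [mul_zero] at this
    exact (this.pow n).const_mul (c n)
  · intro N n
    rw [norm_mul, norm_mul, norm_pow, norm_pow]
    gcongr
    exact norm_mul_pow_le hq N

lemma tendsto_qP {q : ℂ} (hq : ‖q‖ < 1) (a : ℂ) :
    Tendsto (fun N : ℕ => qP q a N) atTop (𝓝 (qPInf q a)) := by
  have hs : Summable (fun m : ℕ => ‖-(a * q ^ m)‖) := by
    simp only [norm_neg, norm_mul, norm_pow]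
    exact (summable_geometric_of_lt_one (norm_nonneg _) hq).mul_left _
  have hm := multipliable_one_add_of_summable hs
  simp only [← sub_eq_add_neg] at hm
  exact hm.hasProd.tendsto_prod_nat

lemma euler_b {q z : ℂ} (hq : ‖q‖ < 1) (hz : ‖z‖ < 1) :
    (∑' n, (qP q q n)⁻¹ * z ^ n) * qPInf q z = 1 := by
  have key : ∀ w : ℂ, ‖w‖ < 1 → (∑' n, (qP q q n)⁻¹ * w ^ n) * (1 - w)
      = ∑' n, (qP q q n)⁻¹ * (w * q) ^ n := by
    intro w hw
    have hwq : ‖w * q‖ < 1 := by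
      have := norm_mul_pow_le (z := w) hq 1
      rw [pow_one] at this
      linarith
    have s1 := (summable_b hq hw).of_norm
    have s2 := (summable_b hq hwq).of_norm
    have : (∑' n, (qP q q n)⁻¹ * w ^ n) - ∑' n, (qP q q n)⁻¹ * (w * q) ^ n
        = (∑' n, (qP q q n)⁻¹ * w ^ n) * w := by
      rw [← s1.tsum_sub s2, (s1.sub s2).tsum_eq_zero_add, ← tsum_mul_right]
      simp only [pow_zero, sub_self, zero_add]
      refine tsum_congr fun n => ?_
      rw [← inv_qP_succ hq n]
      ring
    linear_combination this
  have iter : ∀ N : ℕ, (∑' n, (qP q q n)⁻¹ * z ^ n) * qP q z N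
      = ∑' n, (qP q q n)⁻¹ * (z * q ^ N) ^ n := by
    intro N
    induction N with
    | zero => simp [qP]
    | succ N ih =>
      have h := key (z * q ^ N) (lt_of_le_of_lt (norm_mul_pow_le hq N) hz)
      rw [← ih, mul_assoc, mul_assoc, ← pow_succ] at h
      rw [← h]
      unfold qP
      rw [Finset.prod_range_succ]
  have l1 := (tendsto_qP hq z).const_mul (∑' n, (qP q q n)⁻¹ * z ^ n)
  have l2 := tendsto_series hq _ (summable_b hq hz)
  simp only [iter] at l1
  have := tendsto_nhds_unique l1 l2
  rw [this]
  simp [qP]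

lemma euler_a {q z : ℂ} (hq : ‖q‖ < 1) (hz : ‖z‖ < 1) :
    (∑' n, q ^ (Nat.choose n 2) * (qP q q n)⁻¹ * z ^ n) = qPInf q (-z) := by
  have key : ∀ w : ℂ, ‖w‖ < 1 → (∑' n, q ^ (Nat.choose n 2) * (qP q q n)⁻¹ * w ^ n)
      = (1 + w) * ∑' n, q ^ (Nat.choose n 2) * (qP q q n)⁻¹ * (w * q) ^ n := by
    intro w hw
    have hwq : ‖w * q‖ < 1 := by
      have := norm_mul_pow_le (z := w) hq 1
      rw [pow_one] at this
      linarith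
    have s1 := (summable_a hq hw).of_norm
    have s2 := (summable_a hq hwq).of_norm
    have : (∑' n, q ^ (Nat.choose n 2) * (qP q q n)⁻¹ * w ^ n)
        - ∑' n, q ^ (Nat.choose n 2) * (qP q q n)⁻¹ * (w * q) ^ n
        = (∑' n, q ^ (Nat.choose n 2) * (qP q q n)⁻¹ * (w * q) ^ n) * w := by
      rw [← s1.tsum_sub s2, (s1.sub s2).tsum_eq_zero_add, ← tsum_mul_right]
      simp only [pow_zero, sub_self, zero_add]
      refine tsum_congr fun n => ?_
      have hc : Nat.choose (n + 1) 2 = n + Nat.choose n 2 := by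
        rw [Nat.choose_succ_succ' n 1, Nat.choose_one_right]
      rw [← inv_qP_succ hq n, hc, pow_add]
      ring
    linear_combination this
  have iter : ∀ N : ℕ, (∑' n, q ^ (Nat.choose n 2) * (qP q q n)⁻¹ * z ^ n)
      = qP q (-z) N * ∑' n, q ^ (Nat.choose n 2) * (qP q q n)⁻¹ * (z * q ^ N) ^ n := by
    intro N
    induction N with
    | zero => simp [qP]
    | succ N ih =>
      have h := key (z * q ^ N) (lt_of_le_of_lt (norm_mul_pow_le hq N) hz)
      rw [ih, h, mul_assoc z, ← pow_succ, ← mul_assoc]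
      congr 1
      unfold qP
      rw [Finset.prod_range_succ]
      ring
  have l2 := (tendsto_qP hq (-z)).mul (tendsto_series hq _ (summable_a hq hz))
  simp only [← iter] at l2
  have := tendsto_nhds_unique tendsto_const_nhds l2
  rw [this]
  simp [qP]

/-- Generating function of jagged partitions of bounded length. -/
theorem jagged_bounded_length_generating (q z : ℂ) (hq : ‖q‖ < 1)
    (hz : ‖z‖ < 1) :
    qPInf q (-z) / qPInf q (z ^ 2)
    = ∑' p : ℕ, z ^ p *
        ∑ j ∈ Finset.range (p / 2 + 1),
          q ^ (Nat.choose (p - 2 * j) 2) *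
            ((qP q q (p - 2 * j))⁻¹ * (qP q q j)⁻¹) := by
  have hz2 : ‖z ^ 2‖ < 1 := by
    rw [norm_pow]
    exact pow_lt_one₀ (norm_nonneg _) hz two_ne_zero
  have hb := euler_b hq hz2
  have hne : qPInf q (z ^ 2) ≠ 0 := right_ne_zero_of_mul_eq_one hb
  have hinj : Function.Injective (fun j : ℕ => 2 * j) := fun a b h => by
    simpa using h
  let e : ℕ → ℂ := fun k => if Even k then (qP q q (k / 2))⁻¹ * z ^ k else 0
  have he : ∀ j, e (2 * j) = (qP q q j)⁻¹ * (z ^ 2) ^ j := by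
    intro j
    simp [e, pow_mul]
  have he0 : ∀ k, k ∉ Set.range (fun j : ℕ => 2 * j) → e k = 0 := by
    intro k hk
    have : ¬ Even k := fun h => hk (by
      obtain ⟨r, hr⟩ := h
      exact ⟨r, by simp only; omega⟩)
    simp [e, this]
  have hes : Summable (fun k => ‖e k‖) := by
    rw [← hinj.summable_iff (fun k hk => by rw [he0 k hk, norm_zero])]
    simpa only [Function.comp_def, he] using summable_b hq hz2
  have het : ∑' k, e k = ∑' j, (qP q q j)⁻¹ * (z ^ 2) ^ j := by
    rw [← hinj.tsum_eq (f := e) (fun k hk => by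
      by_contra h
      exact hk (he0 k h))]
    exact tsum_congr he
  have hdiv : qPInf q (-z) / qPInf q (z ^ 2)
      = (∑' k, e k) * ∑' n, q ^ (Nat.choose n 2) * (qP q q n)⁻¹ * z ^ n := by
    rw [div_eq_iff hne, het, euler_a hq hz]
    linear_combination (-qPInf q (-z)) * hb
  rw [hdiv, tsum_mul_tsum_eq_tsum_sum_range_of_summable_norm hes (summable_a hq hz)]
  refine tsum_congr fun p => ?_
  rw [Finset.mul_sum]
  symm
  refine Finset.sum_of_injOn (fun j => 2 * j) hinj.injOn ?_ ?_ ?_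
  · intro j hj
    simp only [Finset.coe_range, Set.mem_Iio] at hj ⊢
    omega
  · intro k hk hk2
    rw [he0 k, zero_mul]
    rintro ⟨j, rfl⟩
    apply hk2
    refine ⟨j, ?_, rfl⟩
    simp only [Finset.coe_range, Set.mem_Iio, Finset.mem_range] at hk ⊢
    omega
  · intro j hj
    rw [Finset.mem_range] at hj
    have hp : z ^ p = (z ^ 2) ^ j * z ^ (p - 2 * j) := by
      rw [← pow_mul, ← pow_add]
      congr 1
      omega
    simp only [he]
    rw [hp]
    ring
end
end
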